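/- arXiv:math/0606074 — 4 statements merged into one kernel-verified Lean document; each statement's English description precedes it below -/
import Mathlib

section
/- Let K be a field of characteristic 2 and V a 2-dimensional K-vector space with basis {x_1, y_1} (i.e., m = 1). Consider the complex DV with differential ∂_k: D_kV → D_{k+2}V given by multiplication by ω = x_1y_1. Then the cohomology H^k(DV) = ker ∂_k / Im ∂_{k−2} satisfies: H^k(DV) = 0 if k is even, and H^k(DV) = D_kV (that is, ∂_k = 0 on all of D_kV and Im ∂_{k−2} = 0) if k is odd. -/
noncomputable section

open Finsupp TensorProduct

/-- The underlying space of the divided power algebra `DV` of a vector space `V` with basis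
indexed by `ι`: the free `K`-module on the set of multi-indices, where a multi-index
`a : ι →₀ ℕ` corresponds to the basis monomial `∏ᵢ vᵢ^{(a i)}`. -/
abbrev DPA (K ι : Type) [Field K] := (ι →₀ ℕ) →₀ K

/-- Total degree of a multi-index. -/
def deg {ι : Type} (a : ι →₀ ℕ) : ℕ := a.sum fun _ e => e

/-- The degree-`k` homogeneous component `D_k V` of the divided power algebra. -/
def Dsub (K ι : Type) [Field K] (k : ℕ) : Submodule K (DPA K ι) :=
  Submodule.span K {f | ∃ a : ι →₀ ℕ, deg a = k ∧ f = Finsupp.single a (1 : K)}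

/-- The structure constant of the divided power algebra:
`(∏ᵢ vᵢ^{(a i)}) ⬝ (∏ᵢ vᵢ^{(b i)}) = (∏ᵢ C(a i + b i, a i)) • ∏ᵢ vᵢ^{(a i + b i)}`. -/
def dpCoef {ι : Type} (a b : ι →₀ ℕ) : ℕ :=
  (a + b).prod fun i _ => Nat.choose (a i + b i) (a i)

/-- Multiplication of the divided power algebra, as a bilinear map. -/
def dpMul (K ι : Type) [Field K] : DPA K ι →ₗ[K] DPA K ι →ₗ[K] DPA K ι :=
  Finsupp.lsum K fun a => LinearMap.toSpanSingleton K _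
    (Finsupp.lsum K fun b => LinearMap.toSpanSingleton K _
      ((dpCoef a b : K) • Finsupp.single (a + b) (1 : K)))

/-- Divided power `w^{(n)} ∈ D_n V` of a vector `w = ∑ᵢ wᵢ vᵢ ∈ V`; it is determined by the
rules `(u+v)^{(a)} = ∑ u^{(i)} v^{(a-i)}` and `(t u)^{(a)} = tᵃ u^{(a)}`. -/
def dpow {K ι : Type} [Field K] [Fintype ι] [DecidableEq ι] (w : ι → K) (n : ℕ) : DPA K ι :=
  ∑ c ∈ Finset.univ.finsuppAntidiag n, Finsupp.single c (c.prod fun i e => w i ^ e)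

/-- The image `∏ᵢ (g vᵢ)^{(a i)}` of the basis monomial `∏ᵢ vᵢ^{(a i)}` under the algebra
endomorphism of `DV` induced by the matrix `g`. -/
def actMon {K ι : Type} [Field K] [Fintype ι] [DecidableEq ι]
    (g : Matrix ι ι K) (a : ι →₀ ℕ) : DPA K ι :=
  (a.support.toList.map fun i => dpow (fun j => g j i) (a i)).foldr
    (fun p q => dpMul K ι p q) (Finsupp.single 0 1)

/-- The algebra endomorphism of `DV` induced by the matrix `g` acting on `V` in the given
basis (for `g` invertible this is the induced algebra automorphism of `DV`). -/
def act {K ι : Type} [Field K] [Fintype ι] [DecidableEq ι] (g : Matrix ι ι K) :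
    DPA K ι →ₗ[K] DPA K ι :=
  Finsupp.lsum K fun a => LinearMap.toSpanSingleton K _ (actMon g a)

/-- The entrywise square of a matrix (giving the Frobenius twist of a representation
in characteristic 2). -/
def matSq {K ι : Type} [Field K] (g : Matrix ι ι K) : Matrix ι ι K :=
  fun i j => g i j * g i j

/-! Symplectic setting: `V` has dimension `2m` and symplectic basis `x_1,y_1,…,x_m,y_m`
indexed by `Fin m × Bool`, with `x_i = (i, false)` and `y_i = (i, true)`. -/

/-- The multi-index of the monomial `x_i y_i`. -/
def xyIdx (m : ℕ) (i : Fin m) : (Fin m × Bool) →₀ ℕ :=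
  Finsupp.single (i, false) 1 + Finsupp.single (i, true) 1

/-- The element `ω = x_1 y_1 + ⋯ + x_m y_m ∈ D_2 V`. -/
def omegaDP (K : Type) [Field K] (m : ℕ) : DPA K (Fin m × Bool) :=
  ∑ i : Fin m, Finsupp.single (xyIdx m i) (1 : K)

/-- The differential `∂` of the complex `DV`: multiplication by `ω`.  It restricts to
`∂_k : D_k V → D_{k+2} V`. -/
def del (K : Type) [Field K] (m : ℕ) :
    DPA K (Fin m × Bool) →ₗ[K] DPA K (Fin m × Bool) :=
  dpMul K (Fin m × Bool) (omegaDP K m)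

/-- The matrix of the non-degenerate alternating bilinear form `f` with `f(x_i, y_j) = δᵢⱼ`,
`f(x_i, x_j) = f(y_i, y_j) = 0`. -/
def Jmat (K : Type) [Field K] (m : ℕ) : Matrix (Fin m × Bool) (Fin m × Bool) K :=
  fun p q => if p.1 = q.1 ∧ p.2 ≠ q.2 then 1 else 0

/-- The condition that the matrix `g` belongs to the symplectic group `Sp(V)`:
`g` preserves the form `f`, i.e. `f(gu, gv) = f(u, v)` for all `u, v ∈ V`. -/
def IsSymplectic {K : Type} [Field K] {m : ℕ}
    (g : Matrix (Fin m × Bool) (Fin m × Bool) K) : Prop :=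
  g.transpose * Jmat K m * g = Jmat K m

/-- The cocycles in degree `k`: `ker ∂_k = ker ∂ ∩ D_k V`. -/
def Zmod (K : Type) [Field K] (m k : ℕ) : Submodule K (DPA K (Fin m × Bool)) :=
  LinearMap.ker (del K m) ⊓ Dsub K (Fin m × Bool) k

/-- The coboundaries in degree `k`: `Im ∂_{k-2} = ∂(D_{k-2} V)`.  (For `k = 0, 1`
truncated subtraction gives `∂(D_0 V) ⊆ D_2 V`, which meets `D_k V` only in `0`,
so no harm is done.) -/
def Bful (K : Type) [Field K] (m k : ℕ) : Submodule K (DPA K (Fin m × Bool)) :=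
  Submodule.map (del K m) (Dsub K (Fin m × Bool) (k - 2))

/-- The cohomology `H^k(DV) = ker ∂_k / Im ∂_{k-2}` of the complex `DV`, realized as the
image of `ker ∂_k` in `DV / Im ∂_{k-2}`. -/
abbrev Hcoh (K : Type) [Field K] (m k : ℕ) :=
  ↥(Submodule.map (Bful K m k).mkQ (Zmod K m k))

/-- The canonical projection `ker ∂_k → H^k(DV)`, sending a cocycle `z` to its
cohomology class `z + Im ∂_{k-2}`. -/
def toH (K : Type) [Field K] (m k : ℕ) : ↥(Zmod K m k) →ₗ[K] Hcoh K m k :=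
  LinearMap.codRestrict _ ((Bful K m k).mkQ.comp (Zmod K m k).subtype)
    (fun z => Submodule.mem_map_of_mem z.2)


lemma deg_bool (a : (Fin 1 × Bool) →₀ ℕ) : deg a = a (0, false) + a (0, true) := by
  unfold deg
  rw [Finsupp.sum_fintype _ _ (fun _ => rfl), Fintype.sum_prod_type]
  simp [add_comm]

lemma mem_Dsub_iff (K ι : Type) [Field K] (k : ℕ) (f : DPA K ι) :
    f ∈ Dsub K ι k ↔ ∀ a, deg a ≠ k → f a = 0 := by
  have h : Dsub K ι k = Finsupp.supported K K {a | deg a = k} := by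
    rw [Finsupp.supported_eq_span_single]
    unfold Dsub
    congr 1
    ext f
    constructor
    · rintro ⟨a, ha, rfl⟩; exact ⟨a, ha, rfl⟩
    · rintro ⟨a, ha, rfl⟩; exact ⟨a, ha, rfl⟩
  rw [h, Finsupp.mem_supported']
  rfl

lemma xy_false : xyIdx 1 0 (0, false) = 1 := by simp [xyIdx]
lemma xy_true : xyIdx 1 0 (0, true) = 1 := by simp [xyIdx]

lemma idx_ext {a b : (Fin 1 × Bool) →₀ ℕ} (h0 : a (0, false) = b (0, false))
    (h1 : a (0, true) = b (0, true)) : a = b := by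
  ext ⟨i, t⟩
  obtain rfl : i = 0 := Subsingleton.elim _ _
  cases t <;> assumption

lemma dpCoef_xy (b : (Fin 1 × Bool) →₀ ℕ) :
    dpCoef (xyIdx 1 0) b = (b (0, false) + 1) * (b (0, true) + 1) := by
  unfold dpCoef Finsupp.prod
  rw [Finset.prod_subset (Finset.subset_univ _), Fintype.prod_prod_type]
  · simp [xy_false, xy_true, add_comm, mul_comm]
  · intro i _ hi
    have : xyIdx 1 0 i + b i = 0 := by simpa using hi
    have h2 : xyIdx 1 0 i = 0 := by omega
    simp [h2]

lemma del_apply (K : Type) [Field K] (f : DPA K (Fin 1 × Bool)) (c : (Fin 1 × Bool) →₀ ℕ) :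
    del K 1 f c = (c (0, false) : K) * (c (0, true) : K) * f (c - xyIdx 1 0) := by
  induction f using Finsupp.induction_linear with
  | zero => simp
  | add f g hf hg => rw [map_add, Finsupp.add_apply, hf, hg, Finsupp.add_apply]; ring
  | single b r =>
    have : del K 1 (Finsupp.single b r) =
        r • ((dpCoef (xyIdx 1 0) b : K) • Finsupp.single (xyIdx 1 0 + b) (1 : K)) := by
      simp [del, omegaDP, dpMul]
    rw [this, dpCoef_xy]
    simp only [Finsupp.smul_apply, smul_eq_mul]
    by_cases h : xyIdx 1 0 + b = c
    · subst h
      rw [Finsupp.single_eq_same, add_tsub_cancel_left, Finsupp.single_eq_same]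
      simp only [Finsupp.add_apply, xy_false, xy_true]
      push_cast
      ring
    · rw [Finsupp.single_eq_of_ne (Ne.symm h)]
      by_cases h0 : c (0, false) = 0
      · simp [h0]
      by_cases h1 : c (0, true) = 0
      · simp [h1]
      rw [Finsupp.single_eq_of_ne]
      · simp
      · rintro rfl
        apply h
        apply idx_ext
        · simp only [Finsupp.add_apply, Finsupp.tsub_apply, xy_false]; omega
        · simp only [Finsupp.add_apply, Finsupp.tsub_apply, xy_true]; omega

lemma cast_even (K : Type) [Field K] [CharP K 2] {n : ℕ} (h : Even n) : (n : K) = 0 :=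
  (CharP.cast_eq_zero_iff K 2 n).2 h.two_dvd

lemma cast_odd (K : Type) [Field K] [CharP K 2] {n : ℕ} (h : Odd n) : (n : K) = 1 := by
  obtain ⟨m, rfl⟩ := h
  rw [Nat.cast_add, cast_even K (even_two_mul m)]; simp

lemma del_del (K : Type) [Field K] [CharP K 2] (f : DPA K (Fin 1 × Bool)) :
    del K 1 (del K 1 f) = 0 := by
  ext c
  rw [del_apply, del_apply]
  simp only [Finsupp.tsub_apply, xy_false, Finsupp.zero_apply]
  rcases Nat.even_or_odd (c (0, false)) with h | h
  · rw [cast_even K h]; simp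
  · have : Even (c (0, false) - 1) := by grind
    rw [cast_even K this]; simp

lemma del_odd (K : Type) [Field K] [CharP K 2] {k : ℕ} (hk : Odd k)
    {f : DPA K (Fin 1 × Bool)} (hf : f ∈ Dsub K (Fin 1 × Bool) k) : del K 1 f = 0 := by
  rw [mem_Dsub_iff] at hf
  ext c
  rw [del_apply, Finsupp.zero_apply]
  rcases Nat.even_or_odd (c (0, false)) with h | h
  · rw [cast_even K h]; simp
  rcases Nat.even_or_odd (c (0, true)) with h' | h'
  · rw [cast_even K h']; simp
  rw [hf, mul_zero]
  rw [deg_bool]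
  simp only [Finsupp.tsub_apply, xy_false, xy_true]
  grind

/-- For `m = 1`: `H^k(DV) = 0` for `k` even (the cocycles in degree `k`
are exactly the coboundaries), and `H^k(DV) = D_k V` for `k` odd (`∂_k` vanishes on all of
`D_k V` and the coboundaries in degree `k` are `0`). -/
theorem statement_2 (K : Type) [Field K] [CharP K 2] (k : ℕ) :
    (Even k →
      LinearMap.ker (del K 1) ⊓ Dsub K (Fin 1 × Bool) k
        = Bful K 1 k ⊓ Dsub K (Fin 1 × Bool) k) ∧
    (Odd k →
      Dsub K (Fin 1 × Bool) k ≤ LinearMap.ker (del K 1) ∧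
      Bful K 1 k ⊓ Dsub K (Fin 1 × Bool) k = ⊥) := by
  refine ⟨fun hk => le_antisymm ?_ ?_, fun hk => ⟨fun f hf => del_odd K hk hf, ?_⟩⟩
  · rintro f ⟨hf, hfk⟩
    refine ⟨?_, hfk⟩
    have hf' : del K 1 f = 0 := hf
    have hfk' := (mem_Dsub_iff K _ k f).1 hfk
    let g : DPA K (Fin 1 × Bool) :=
      Finsupp.comapDomain (fun b => b + xyIdx 1 0) f (add_left_injective _).injOn
    have hg : ∀ b, g b = f (b + xyIdx 1 0) := fun b => rfl
    refine ⟨g, ?_, ?_⟩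
    · refine (mem_Dsub_iff K _ _ g).2 fun b hb => ?_
      rw [hg]
      apply hfk'
      rw [deg_bool] at hb ⊢
      simp only [Finsupp.add_apply, xy_false, xy_true]
      omega
    · ext c
      rw [del_apply, hg]
      by_cases hpos : 0 < c (0, false) ∧ 0 < c (0, true)
      · have hc : c - xyIdx 1 0 + xyIdx 1 0 = c := by
          apply idx_ext
          · simp only [Finsupp.add_apply, Finsupp.tsub_apply, xy_false]; omega
          · simp only [Finsupp.add_apply, Finsupp.tsub_apply, xy_true]; omega
        rw [hc]
        by_cases hd : deg c = k
        · rw [deg_bool] at hd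
          rcases Nat.even_or_odd (c (0, false)) with h | h
          · have h1 : Even (c (0, true)) := by grind
            have := DFunLike.congr_fun hf' (c + xyIdx 1 0)
            rw [del_apply, add_tsub_cancel_right] at this
            simp only [Finsupp.add_apply, xy_false, xy_true] at this
            rw [cast_odd K h.add_one, cast_odd K h1.add_one] at this
            have h0 : f c = 0 := by simpa using this
            simp [h0]
          · have h1 : Odd (c (0, true)) := by grind
            rw [cast_odd K h, cast_odd K h1]; simp
        · rw [hfk' c hd]; simp
      · have h0 : f c = 0 := by
          by_cases hd : deg c = k
          · rw [deg_bool] at hd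
            have := DFunLike.congr_fun hf' (c + xyIdx 1 0)
            rw [del_apply, add_tsub_cancel_right] at this
            simp only [Finsupp.add_apply, xy_false, xy_true] at this
            have he : Even (c (0, false)) ∧ Even (c (0, true)) := by grind
            rw [cast_odd K he.1.add_one, cast_odd K he.2.add_one] at this
            simpa using this
          · exact hfk' c hd
        have : c (0, false) = 0 ∨ c (0, true) = 0 := by omega
        rw [h0]
        rcases this with h | h <;> simp [h]
  · rintro f ⟨⟨g, -, rfl⟩, hfk⟩
    exact ⟨del_del K g, hfk⟩
  · rw [eq_bot_iff]
    rintro f ⟨⟨g, hg, rfl⟩, hfk⟩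
    rw [Submodule.mem_bot]
    by_cases h : 2 ≤ k
    · exact del_odd K (by grind) hg
    · have hg' := (mem_Dsub_iff K _ _ g).1 hg
      have hfk' := (mem_Dsub_iff K _ _ _).1 hfk
      ext c
      by_cases hd : deg c = k
      · rw [deg_bool] at hd
        have : c (0, false) = 0 ∨ c (0, true) = 0 := by omega
        rw [del_apply]
        rcases this with h | h <;> simp [h]
      · exact hfk' c hd

end
end

section
/- Let K be an algebraically closed field of characteristic 2 and V a K-vector space of dimension 2m with symplectic basis x_1,y_1,...,x_m,y_m and associated alternating form f. The symplectic group Sp(V) acts on each D_kV via the induced algebra automorphisms of DV, and since the differential ∂ is Sp(V)-equivariant, Sp(V) acts on H^m(DV) = ker ∂_m / Im ∂_{m−2}. Then H^m(DV) is an irreducible Sp(V)-module: its only Sp(V)-invariant subspaces are 0 and H^m(DV) itself, and H^m(DV) ≠ 0. -/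
noncomputable section

open Finsupp TensorProduct

section Helpers

theorem s9_dpMul_single {K ι : Type} [Field K] (a b : ι →₀ ℕ) (x y : K) :
    dpMul K ι (Finsupp.single a x) (Finsupp.single b y)
      = Finsupp.single (a + b) (x * y * (dpCoef a b : K)) := by
  simp only [dpMul, Finsupp.lsum_single, LinearMap.toSpanSingleton_apply, LinearMap.smul_apply,
    Finsupp.smul_single, smul_eq_mul, mul_one, mul_assoc]

theorem s9_dpCoef_eq {ι : Type} [Fintype ι] (a b : ι →₀ ℕ) :
    dpCoef a b = ∏ i, Nat.choose (a i + b i) (a i) := by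
  classical
  unfold dpCoef Finsupp.prod
  apply Finset.prod_subset (Finset.subset_univ _)
  intro i _ hi
  simp only [Finsupp.mem_support_iff, Finsupp.add_apply, not_not] at hi
  have h1 : a i = 0 := by omega
  simp [h1]

theorem s9_dpMul_var {K ι : Type} [Field K] [Fintype ι] [DecidableEq ι] (p : ι) (a : ι →₀ ℕ)
    (h : a p = 0) :
    dpMul K ι (Finsupp.single (Finsupp.single p 1) 1) (Finsupp.single a 1)
      = Finsupp.single (Finsupp.single p 1 + a) 1 := by
  rw [s9_dpMul_single, s9_dpCoef_eq]
  have : (∏ i, Nat.choose ((Finsupp.single p 1 : ι →₀ ℕ) i + a i)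
      ((Finsupp.single p 1 : ι →₀ ℕ) i)) = 1 := by
    apply Finset.prod_eq_one
    intro i _
    by_cases hi : p = i
    · subst hi; simp [h]
    · simp [Finsupp.single_apply, hi]
  rw [this]; simp

theorem s9_dpow_one {K ι : Type} [Field K] [Fintype ι] [DecidableEq ι] (w : ι → K) :
    dpow w 1 = ∑ j, Finsupp.single (Finsupp.single j 1) (w j) := by
  have : (Finset.univ.finsuppAntidiag 1 : Finset (ι →₀ ℕ))
      = Finset.univ.image (fun j : ι => (Finsupp.single j 1 : ι →₀ ℕ)) := by
    ext c
    simp only [Finset.mem_finsuppAntidiag, Finset.subset_univ, and_true, Finset.mem_image,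
      Finset.mem_univ, true_and]
    constructor
    · intro h
      obtain ⟨j, hj⟩ : ∃ j, c j ≠ 0 := by
        by_contra hcon
        push Not at hcon
        simp [hcon] at h
      refine ⟨j, ?_⟩
      rw [← Finset.add_sum_erase _ _ (Finset.mem_univ j)] at h
      have h0 : ∑ x ∈ Finset.univ.erase j, c x = 0 := by omega
      rw [Finset.sum_eq_zero_iff] at h0
      ext i
      by_cases hi : j = i
      · subst hi; simp; omega
      · simp [Finsupp.single_apply, hi]
        exact (h0 i (by simp [Ne.symm hi])).symm
    · rintro ⟨j, rfl⟩
      simp [Finsupp.single_apply]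
  unfold dpow
  rw [this, Finset.sum_image]
  · apply Finset.sum_congr rfl
    intro j _
    simp
  · intro a _ b _ hab
    exact Finsupp.single_left_injective one_ne_zero hab

theorem s9_foldA {K ι : Type} [Field K] [Fintype ι] [DecidableEq ι] (L : List ι) (hL : L.Nodup) :
    (L.map fun p => (Finsupp.single (Finsupp.single p 1) 1 : DPA K ι)).foldr
      (fun p q => dpMul K ι p q) (Finsupp.single 0 1)
      = Finsupp.single (L.map fun p => (Finsupp.single p 1 : ι →₀ ℕ)).sum 1 := by
  induction L with
  | nil => simp
  | cons p t ih =>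
    rw [List.nodup_cons] at hL
    simp only [List.map_cons, List.foldr_cons, List.sum_cons]
    rw [ih hL.2]
    apply s9_dpMul_var
    have : ∀ t : List ι, p ∉ t → (t.map fun p => (Finsupp.single p 1 : ι →₀ ℕ)).sum p = 0 := by
      intro t
      induction t with
      | nil => simp
      | cons q t ih =>
        intro h
        rw [List.mem_cons, not_or] at h
        simp [ih h.2, Finsupp.single_apply, Ne.symm h.1]
    exact this t hL.1

theorem s9_foldB {K ι : Type} [Field K] [Fintype ι] [DecidableEq ι] (p0 p1 : ι) (L : List ι)
    (hL : L.Nodup) (h0 : p0 ∈ L) (h1 : p1 ∉ L) :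
    (L.map fun p => (if p = p0 then Finsupp.single (Finsupp.single p0 1) 1
        + Finsupp.single (Finsupp.single p1 1) 1
        else Finsupp.single (Finsupp.single p 1) 1 : DPA K ι)).foldr
      (fun p q => dpMul K ι p q) (Finsupp.single 0 1)
      = Finsupp.single (L.map fun p => (Finsupp.single p 1 : ι →₀ ℕ)).sum 1
      + Finsupp.single (L.map fun p => (Finsupp.single (if p = p0 then p1 else p) 1 : ι →₀ ℕ)).sum 1
      := by
  have hmm : ∀ t : List ι, (t.map fun p => (Finsupp.single (if p = p0 then p1 else p) 1 : ι →₀ ℕ))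
      = (t.map fun p => if p = p0 then p1 else p).map fun p => (Finsupp.single p 1 : ι →₀ ℕ) := by
    intro t; simp [Function.comp_def]
  induction L with
  | nil => simp at h0
  | cons p t ih =>
    have hL' := hL
    rw [List.nodup_cons] at hL
    rw [List.mem_cons, not_or] at h1
    by_cases hp : p = p0
    · subst hp
      have e1 : (t.map fun q => (if q = p then Finsupp.single (Finsupp.single p 1) 1
        + Finsupp.single (Finsupp.single p1 1) 1
        else Finsupp.single (Finsupp.single q 1) 1 : DPA K ι))
        = t.map fun q => (Finsupp.single (Finsupp.single q 1) 1 : DPA K ι) := by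
        apply List.map_congr_left
        intro q hq
        rw [if_neg]; rintro rfl; exact hL.1 hq
      have e2 : (t.map fun q => (Finsupp.single (if q = p then p1 else q) 1 : ι →₀ ℕ))
        = t.map fun q => (Finsupp.single q 1 : ι →₀ ℕ) := by
        apply List.map_congr_left
        intro q hq
        rw [if_neg]; rintro rfl; exact hL.1 hq
      have A1 := s9_foldA (K := K) (p :: t) hL'
      have A2 := s9_foldA (K := K) (p1 :: t) (List.nodup_cons.2 ⟨h1.2, hL.2⟩)
      simp only [List.map_cons, List.foldr_cons, List.sum_cons] at A1 A2 ⊢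
      rw [e1, e2]
      simp only [if_true, map_add, LinearMap.add_apply]
      rw [A1, A2]
    · have h0' : p0 ∈ t := by
        rcases List.mem_cons.1 h0 with h | h
        · exact absurd h.symm hp
        · exact h
      have ih' := ih hL.2 h0' h1.2
      have hnd : (t.map fun p => if p = p0 then p1 else p).Nodup := by
        apply List.Nodup.map_on _ hL.2
        intro x hx y hy hxy
        split_ifs at hxy with hx0 hy0 hy0
        · rw [hx0, hy0]
        · exact absurd (hxy ▸ hy) h1.2
        · exact absurd (hxy ▸ hx) h1.2
        · exact hxy
      have hpn : p ∉ (t.map fun p => if p = p0 then p1 else p) := by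
        rw [List.mem_map]
        rintro ⟨q, hq, hqp⟩
        split_ifs at hqp with hq0
        · exact h1.1 hqp
        · exact hL.1 (hqp ▸ hq)
      have A1 := s9_foldA (K := K) (p :: t) hL'
      have A2 := s9_foldA (K := K) (p :: t.map fun p => if p = p0 then p1 else p)
        (List.nodup_cons.2 ⟨hpn, hnd⟩)
      have A1' := s9_foldA (K := K) t hL.2
      have A2' := s9_foldA (K := K) (t.map fun p => if p = p0 then p1 else p) hnd
      simp only [List.map_cons, List.foldr_cons, List.sum_cons, if_neg hp] at A1 A2 ⊢
      rw [ih', map_add, hmm, ← A1, ← A2, A1', A2']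

/-- The multi-index of the monomial picking `x_i` or `y_i` for each `i`. -/
def s9e {m : ℕ} (s : Fin m → Bool) : (Fin m × Bool) →₀ ℕ :=
  ∑ i, Finsupp.single (i, s i) 1

theorem s9e_apply {m : ℕ} (s : Fin m → Bool) (i : Fin m) (b : Bool) :
    s9e s (i, b) = if s i = b then 1 else 0 := by
  unfold s9e
  rw [Finsupp.finsetSum_apply]
  simp only [Finsupp.single_apply, Prod.mk.injEq]
  rw [Finset.sum_eq_single i]
  · simp
  · intro j _ hj; simp [hj]
  · simp

theorem s9e_inj {m : ℕ} {s t : Fin m → Bool} (h : s9e s = s9e t) : s = t := by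
  funext i
  have := DFunLike.congr_fun h (i, s i)
  rw [s9e_apply, s9e_apply] at this
  by_contra hc
  simp [Ne.symm hc] at this

theorem s9e_support {m : ℕ} (s : Fin m → Bool) :
    (s9e s).support = Finset.univ.image (fun i => (i, s i)) := by
  ext ⟨i, b⟩
  rw [Finsupp.mem_support_iff, s9e_apply]
  simp

theorem s9e_supsum {m : ℕ} {M : Type} [AddCommMonoid M] (s : Fin m → Bool) (f : Fin m × Bool → M) :
    ((s9e s).support.toList.map f).sum = ∑ i, f (i, s i) := by
  rw [Finset.sum_map_toList, s9e_support, Finset.sum_image]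
  intro a _ b _ h
  exact (Prod.mk.inj h).1

/-- The transvection at `i` sending `(i,b)` to `(i,b) + (i,!b)`. -/
def s9g (K : Type) [Field K] {m : ℕ} (i : Fin m) (b : Bool) :
    Matrix (Fin m × Bool) (Fin m × Bool) K :=
  fun q p => (if q = p then 1 else 0) + (if p = (i, b) ∧ q = (i, !b) then 1 else 0)

theorem s9g_symp (K : Type) [Field K] [CharP K 2] {m : ℕ} (i : Fin m) (b : Bool) :
    IsSymplectic (s9g K i b) := by
  have hJ : ∀ p q : Fin m × Bool, Jmat K m p q = if q = (p.1, !p.2) then 1 else 0 := by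
    rintro ⟨p, c⟩ ⟨q, d⟩
    unfold Jmat
    congr 1
    simp only [Prod.mk.injEq, eq_iff_iff]
    constructor
    · rintro ⟨h1, h2⟩; refine ⟨h1.symm, ?_⟩; cases c <;> cases d <;> simp_all
    · rintro ⟨h1, h2⟩; refine ⟨h1.symm, ?_⟩; cases c <;> cases d <;> simp_all
  unfold IsSymplectic
  have h2 : (1 : K) + 1 = 0 := by
    have := CharP.cast_eq_zero K 2
    push_cast at this
    rw [← this]; norm_num
  ext ⟨p, c⟩ ⟨q, d⟩
  have e : ∀ (v : Fin m × Bool → K) (q : Fin m × Bool),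
      ∑ r, v r * s9g K i b r q = v q + if q = (i, b) then v (i, !b) else 0 := by
    intro v q
    simp only [s9g, mul_add, Finset.sum_add_distrib]
    simp
    by_cases hq : q = (i, b) <;> simp [hq]
  have e' : ∀ r, (((s9g K i b).transpose * Jmat K m) (p, c) r) =
      Jmat K m (p, c) r + if (p, c) = (i, b) then Jmat K m (i, !b) r else 0 := by
    intro r
    rw [← e (fun l => Jmat K m l r) (p, c)]
    simp [Matrix.mul_apply, mul_comm]
  rw [Matrix.mul_apply, e]
  rw [e', e', hJ, hJ, hJ, hJ]
  by_cases hp : p = i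
  · by_cases hq : q = i
    · subst hp; subst hq
      cases b <;> cases c <;> cases d <;> simp [h2]
    · subst hp
      simp [hq]
  · by_cases hq : q = i
    · subst hq
      simp [hp, Ne.symm hp]
    · simp [hp, hq]

theorem s9g_dpow (K : Type) [Field K] {m : ℕ} (i : Fin m) (b : Bool) (p : Fin m × Bool) :
    dpow (fun j => s9g K i b j p) 1 =
      if p = (i, b) then Finsupp.single (Finsupp.single (i, b) 1) 1
        + Finsupp.single (Finsupp.single (i, !b) 1) 1
        else Finsupp.single (Finsupp.single p 1) 1 := by
  rw [s9_dpow_one]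
  simp only [s9g, Finsupp.single_add, Finset.sum_add_distrib]
  have h1 : ∑ x : Fin m × Bool, Finsupp.single (Finsupp.single x 1 : (Fin m × Bool) →₀ ℕ)
      (if x = p then (1 : K) else 0) = Finsupp.single (Finsupp.single p 1) 1 := by
    rw [Finset.sum_eq_single p]
    · simp
    · intro q _ hq; simp [hq]
    · simp
  rw [h1]
  split_ifs with hp
  · rw [Finset.sum_eq_single (i, !b)]
    · simp [hp]
    · intro q _ hq; simp [hq]
    · simp
  · simp [hp]

theorem s9_act_e (K : Type) [Field K] {m : ℕ} (i : Fin m) (b : Bool) (s : Fin m → Bool) :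
    act (s9g K i b) (Finsupp.single (s9e s) 1) =
      Finsupp.single (s9e s) 1 +
        if s i = b then Finsupp.single (s9e (Function.update s i (!b))) 1 else 0 := by
  have h1 : act (s9g K i b) (Finsupp.single (s9e s) 1) = actMon (s9g K i b) (s9e s) := by
    simp [act]
  rw [h1]
  unfold actMon
  have h2 : ((s9e s).support.toList.map fun q => dpow (fun j => s9g K i b j q) (s9e s q))
    = (s9e s).support.toList.map fun p =>
      if p = (i, b) then Finsupp.single (Finsupp.single (i, b) 1) 1
        + Finsupp.single (Finsupp.single (i, !b) 1) 1
        else Finsupp.single (Finsupp.single p 1) 1 := by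
    apply List.map_congr_left
    rintro q hq
    have : s9e s q = 1 := by
      rw [Finset.mem_toList, s9e_support, Finset.mem_image] at hq
      obtain ⟨j, _, rfl⟩ := hq
      simp [s9e_apply]
    rw [this, s9g_dpow]
  rw [h2]
  by_cases hs : s i = b
  · rw [s9_foldB]
    · rw [s9e_supsum, s9e_supsum, if_pos hs]
      congr 2
      apply Finset.sum_congr rfl
      intro j _
      congr 1
      by_cases hj : j = i
      · subst hj; simp [hs]
      · simp [hj]
    · exact Finset.nodup_toList _
    · rw [Finset.mem_toList, Finsupp.mem_support_iff, s9e_apply]; simp [hs]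
    · rw [Finset.mem_toList, Finsupp.mem_support_iff, s9e_apply]; simp [hs]
  · have h3 : ((s9e s).support.toList.map fun p =>
      (if p = (i, b) then Finsupp.single (Finsupp.single (i, b) 1) 1
        + Finsupp.single (Finsupp.single (i, !b) 1) 1
        else Finsupp.single (Finsupp.single p 1) 1 : DPA K (Fin m × Bool))) =
        (s9e s).support.toList.map fun p => Finsupp.single (Finsupp.single p 1) 1 := by
      apply List.map_congr_left
      rintro q hq
      rw [if_neg]
      rintro rfl
      rw [Finset.mem_toList, Finsupp.mem_support_iff, s9e_apply] at hq
      simp [hs] at hq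
    rw [h3, s9_foldA _ (Finset.nodup_toList _), s9e_supsum, if_neg hs, add_zero]
    rfl

theorem s9_irr {K : Type} [Field K] {m : ℕ} (U : Submodule K ((Fin m → Bool) → K))
    (hU : ∀ i b, ∀ c ∈ U, (fun t : Fin m → Bool =>
      if t i = !b then c (Function.update t i b) else 0) ∈ U) : U = ⊥ ∨ U = ⊤ := by
  classical
  by_cases h : U = ⊥
  · exact Or.inl h
  right
  obtain ⟨c, hc, hc0⟩ := Submodule.exists_mem_ne_zero_of_ne_bot h
  obtain ⟨s, hs⟩ := Function.ne_iff.1 hc0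
  have hpi : ∀ i b, ∀ c ∈ U, (fun t : Fin m → Bool => if t i = b then c t else 0) ∈ U := by
    intro i b c hc
    convert hU i (!b) _ (hU i b c hc) using 1
    funext t
    by_cases ht : t i = b
    · subst ht; simp
    · simp [ht]
  have h1 : ∀ F : Finset (Fin m), (fun t => if ∀ i ∈ F, t i = s i then c t else 0) ∈ U := by
    intro F
    induction F using Finset.induction_on with
    | empty => simpa using hc
    | insert i F hi ih =>
      convert hpi i (s i) _ ih using 1
      funext t
      by_cases ht : t i = s i <;> simp [ht]
  have h2 : (Pi.single s 1 : (Fin m → Bool) → K) ∈ U := by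
    have := U.smul_mem (c s)⁻¹ (h1 Finset.univ)
    convert this using 1
    funext t
    by_cases ht : t = s
    · subst ht; simp [inv_mul_cancel₀ hs]
    · have : ¬ ∀ i, t i = s i := fun h => ht (funext h)
      simp [ht, this]
  have h3 : ∀ t : Fin m → Bool, (Pi.single t 1 : (Fin m → Bool) → K) ∈ U := by
    intro t
    have : ∀ F : Finset (Fin m), (Pi.single (fun i => if i ∈ F then t i else s i) 1 :
        (Fin m → Bool) → K) ∈ U := by
      intro F
      induction F using Finset.induction_on with
      | empty => simpa using h2
      | insert i F hi ih =>
        by_cases hts : t i = s i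
        · convert ih using 2
          funext j
          by_cases hj : j = i
          · subst hj; simp [hi, hts]
          · simp [hj]
        · convert hU i (s i) _ ih using 1
          funext u
          have hti : t i = !(s i) := by
            cases h1 : t i <;> cases h2 : s i <;> simp_all
          simp only [Pi.single_apply]
          by_cases hu : u i = !(s i)
          · rw [if_pos hu]
            congr 1
            rw [eq_iff_iff]
            constructor
            · rintro rfl
              funext j
              by_cases hj : j = i
              · subst hj; simp [hi]
              · simp [hj]
            · intro hh
              funext j
              by_cases hj : j = i
              · subst hj; simp [hu, hti]
              · have := congrFun hh j
                simpa [hj] using this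
          · rw [if_neg hu, if_neg]
            rintro rfl
            simp [hti] at hu
    simpa using this Finset.univ
  rw [eq_top_iff]
  rintro f -
  rw [← Finset.univ_sum_single f]
  apply Submodule.sum_mem
  intro t _
  have := U.smul_mem (f t) (h3 t)
  rwa [← Pi.single_smul, smul_eq_mul, mul_one] at this

theorem s9_mem_Dsub {K ι : Type} [Field K] (k : ℕ) (f : DPA K ι) :
    f ∈ Dsub K ι k ↔ ∀ a, f a ≠ 0 → deg a = k := by
  have : Dsub K ι k = Finsupp.supported K K {a : ι →₀ ℕ | deg a = k} := by
    rw [Finsupp.supported_eq_span_single]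
    unfold Dsub
    congr 1
    ext f
    simp [eq_comm]
  rw [this, Finsupp.mem_supported]
  simp only [Set.subset_def, Finset.mem_coe, Finsupp.mem_support_iff, Set.mem_ofPred_eq]

theorem s9_deg_eq {ι : Type} [Fintype ι] (a : ι →₀ ℕ) : deg a = ∑ i, a i := by
  unfold deg
  exact Finsupp.sum_fintype _ _ (fun _ => rfl)

theorem s9_deg_eq2 {m : ℕ} (a : (Fin m × Bool) →₀ ℕ) :
    deg a = ∑ i, (a (i, false) + a (i, true)) := by
  rw [s9_deg_eq, Fintype.sum_prod_type]
  apply Finset.sum_congr rfl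
  intro i _
  simp [add_comm]

theorem s9_xy_apply {m : ℕ} (i j : Fin m) (b : Bool) :
    xyIdx m i (j, b) = if i = j then 1 else 0 := by
  unfold xyIdx
  cases b <;> simp [Finsupp.single_apply]

theorem s9_dpCoef_xy {m : ℕ} (i : Fin m) (c : (Fin m × Bool) →₀ ℕ) :
    dpCoef (xyIdx m i) c = (c (i, false) + 1) * (c (i, true) + 1) := by
  rw [s9_dpCoef_eq, Fintype.prod_prod_type, Finset.prod_eq_single i]
  · simp [s9_xy_apply]; ring
  · intro j _ hj
    simp [s9_xy_apply, Ne.symm hj]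
  · simp

theorem s9_del_single (K : Type) [Field K] {m : ℕ} (c : (Fin m × Bool) →₀ ℕ) :
    del K m (Finsupp.single c 1) = ∑ j, Finsupp.single (xyIdx m j + c)
      (((c (j, false) + 1) * (c (j, true) + 1) : ℕ) : K) := by
  unfold del omegaDP
  rw [map_sum, LinearMap.sum_apply]
  apply Finset.sum_congr rfl
  intro j _
  rw [s9_dpMul_single, s9_dpCoef_xy]; simp

/-- value of the `i`-th homotopy at a monomial -/
def s9hm (K : Type) [Field K] {m : ℕ} (i : Fin m) (c : (Fin m × Bool) →₀ ℕ) :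
    DPA K (Fin m × Bool) :=
  open Classical in
  if Odd (c (i, false)) ∧ Odd (c (i, true)) then Finsupp.single (c - xyIdx m i) 1 else 0

/-- indices of even parity -/
def s9ev {m : ℕ} (c : (Fin m × Bool) →₀ ℕ) : Finset (Fin m) :=
  open Classical in
  Finset.univ.filter fun i => Even (c (i, false) + c (i, true))

/-- value of the total homotopy at a monomial -/
def s9Hm (K : Type) [Field K] {m : ℕ} (c : (Fin m × Bool) →₀ ℕ) :
    DPA K (Fin m × Bool) :=
  open Classical in
  if h : (s9ev c).Nonempty then s9hm K ((s9ev c).min' h) c else 0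

/-- `i`-th homotopy -/
def s9h (K : Type) [Field K] {m : ℕ} (i : Fin m) :
    DPA K (Fin m × Bool) →ₗ[K] DPA K (Fin m × Bool) :=
  Finsupp.lsum K fun c => LinearMap.toSpanSingleton K _ (s9hm K i c)

/-- total homotopy -/
def s9H (K : Type) [Field K] (m : ℕ) :
    DPA K (Fin m × Bool) →ₗ[K] DPA K (Fin m × Bool) :=
  Finsupp.lsum K fun c => LinearMap.toSpanSingleton K _ (s9Hm K c)

theorem s9h_single (K : Type) [Field K] {m : ℕ} (i : Fin m) (c : (Fin m × Bool) →₀ ℕ) (x : K) :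
    s9h K i (Finsupp.single c x) = x • s9hm K i c := by
  simp [s9h]

theorem s9H_single (K : Type) [Field K] {m : ℕ} (c : (Fin m × Bool) →₀ ℕ) (x : K) :
    s9H K m (Finsupp.single c x) = x • s9Hm K c := by
  simp [s9H]

theorem s9_ev_xy {m : ℕ} (j : Fin m) (c : (Fin m × Bool) →₀ ℕ) :
    s9ev (xyIdx m j + c) = s9ev c := by
  unfold s9ev
  ext i
  simp only [Finset.mem_filter, Finset.mem_univ, true_and, Finsupp.add_apply, s9_xy_apply]
  split_ifs
  · rw [show 1 + c (i, false) + (1 + c (i, true)) = c (i, false) + c (i, true) + 2 by ring]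
    simp [Nat.even_add]
  · simp

theorem s9_char2 {K : Type} [Field K] [CharP K 2] : (2 : K) = 0 := by
  have := CharP.cast_eq_zero K 2
  exact_mod_cast this

theorem s9_cast_even {K : Type} [Field K] [CharP K 2] {n : ℕ} (h : Even n) : (n : K) = 0 := by
  obtain ⟨k, rfl⟩ := h
  push_cast
  rw [← two_mul, s9_char2, zero_mul]

theorem s9_cast_odd {K : Type} [Field K] [CharP K 2] {n : ℕ} (h : Odd n) : (n : K) = 1 := by
  obtain ⟨k, rfl⟩ := h
  push_cast
  rw [s9_char2, zero_mul, zero_add]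

theorem s9_homotopy_i (K : Type) [Field K] [CharP K 2] {m : ℕ} (i : Fin m)
    (c : (Fin m × Bool) →₀ ℕ) (hc : Even (c (i, false) + c (i, true))) :
    s9h K i (del K m (Finsupp.single c 1)) + del K m (s9hm K i c) = Finsupp.single c 1 := by
  rw [s9_del_single, map_sum]
  simp only [s9h_single]
  by_cases ho : Odd (c (i, false)) ∧ Odd (c (i, true))
  · obtain ⟨d, rfl⟩ : ∃ d, c = xyIdx m i + d := by
      refine ⟨c - xyIdx m i, ?_⟩
      ext ⟨j, b⟩
      have := ho.1.pos
      have := ho.2.pos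
      simp only [Finsupp.add_apply, Finsupp.tsub_apply, s9_xy_apply]
      split_ifs with h
      · subst h; cases b <;> omega
      · omega
    simp only [Finsupp.add_apply, s9_xy_apply, if_true] at ho
    have hd1 : Even (d (i, false)) := by
      have := ho.1; rw [Nat.odd_add] at this; simpa using this
    have hd2 : Even (d (i, true)) := by
      have := ho.2; rw [Nat.odd_add] at this; simpa using this
    have h1 : s9hm K i (xyIdx m i + d) = Finsupp.single d 1 := by
      unfold s9hm
      rw [if_pos]
      · rw [add_tsub_cancel_left]
      · simpa only [Finsupp.add_apply, s9_xy_apply, if_true] using ho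
    rw [h1, s9_del_single]
    rw [← Finset.add_sum_erase _ _ (Finset.mem_univ i)]
    rw [← Finset.add_sum_erase Finset.univ (fun j => Finsupp.single (xyIdx m j + d) _)
      (Finset.mem_univ i)]
    rw [s9_cast_even (K := K), zero_smul, zero_add, s9_cast_odd (K := K)
      (n := (d (i, false) + 1) * (d (i, true) + 1))]
    · have h2 : ∑ j ∈ Finset.univ.erase i,
          ((((xyIdx m i + d) (j, false) + 1) * ((xyIdx m i + d) (j, true) + 1) : ℕ) : K)
            • s9hm K i (xyIdx m j + (xyIdx m i + d)) =
          ∑ j ∈ Finset.univ.erase i, Finsupp.single (xyIdx m j + d)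
            (((d (j, false) + 1) * (d (j, true) + 1) : ℕ) : K) := by
        apply Finset.sum_congr rfl
        intro j hj
        have hji : j ≠ i := (Finset.mem_erase.1 hj).1
        simp only [Finsupp.add_apply, s9_xy_apply, if_neg hji.symm, zero_add]
        have h3 : s9hm K i (xyIdx m j + (xyIdx m i + d)) = Finsupp.single (xyIdx m j + d) 1 := by
          unfold s9hm
          rw [if_pos]
          · rw [add_left_comm, add_tsub_cancel_left]
          · simp only [Finsupp.add_apply, s9_xy_apply, if_true, if_neg hji, zero_add]
            exact ho
        rw [h3]; simp
      rw [h2, add_left_comm, ← two_nsmul]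
      ext a
      simp [s9_char2]
    · exact hd1.add_one.mul hd2.add_one
    · simp only [Finsupp.add_apply, s9_xy_apply, if_true]
      exact ho.1.add_one.mul_right _
  · have he : Even (c (i, false)) ∧ Even (c (i, true)) := by
      rw [Nat.even_add] at hc
      simp only [← Nat.not_even_iff_odd] at ho
      tauto
    have h1 : s9hm K i c = 0 := by
      unfold s9hm; rw [if_neg ho]
    rw [h1, map_zero, add_zero, Finset.sum_eq_single i]
    · rw [s9_cast_odd (he.1.add_one.mul he.2.add_one), one_smul]
      unfold s9hm
      rw [if_pos, add_tsub_cancel_left]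
      simp only [Finsupp.add_apply, s9_xy_apply, if_true]
      rw [add_comm 1, add_comm 1]
      exact ⟨he.1.add_one, he.2.add_one⟩
    · intro j _ hji
      have : s9hm K i (xyIdx m j + c) = 0 := by
        unfold s9hm
        rw [if_neg]
        simpa only [Finsupp.add_apply, s9_xy_apply, if_neg hji, zero_add] using ho
      rw [this, smul_zero]
    · simp

theorem s9_homotopy (K : Type) [Field K] [CharP K 2] {m : ℕ}
    (c : (Fin m × Bool) →₀ ℕ) :
    s9H K m (del K m (Finsupp.single c 1)) + del K m (s9Hm K c) =
      open Classical in if (s9ev c).Nonempty then Finsupp.single c 1 else 0 := by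
  by_cases h : (s9ev c).Nonempty
  · have hi := Finset.min'_mem _ h
    set i := (s9ev c).min' h with hidef
    have hE : Even (c (i, false) + c (i, true)) := by
      simpa [s9ev] using hi
    rw [if_pos h, ← s9_homotopy_i K i c hE]
    congr 1
    · rw [s9_homotopy_i K i c hE, s9_del_single, map_sum, map_sum]
      apply Finset.sum_congr rfl
      intro j _
      rw [s9H_single, s9h_single]
      congr 1
      unfold s9Hm
      have h' : (s9ev (xyIdx m j + c)).Nonempty := by rw [s9_ev_xy]; exact h
      rw [dif_pos h']
      congr 1
      simp only [s9_ev_xy]; rfl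
    · unfold s9Hm
      rw [dif_pos h]
  · rw [if_neg h, s9_del_single, map_sum]
    have h0 : s9Hm K c = 0 := by unfold s9Hm; rw [dif_neg h]
    rw [h0, map_zero, add_zero]
    apply Finset.sum_eq_zero
    intro j _
    rw [s9H_single]
    unfold s9Hm
    rw [dif_neg, smul_zero]
    rw [s9_ev_xy]; exact h

theorem s9_Hm_deg (K : Type) [Field K] {m : ℕ} (c : (Fin m × Bool) →₀ ℕ) :
    s9Hm K c ∈ Dsub K (Fin m × Bool) (deg c - 2) := by
  unfold s9Hm
  split_ifs with h
  · generalize (s9ev c).min' h = i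
    unfold s9hm
    split_ifs with ho
    · apply Submodule.subset_span
      refine ⟨_, ?_, rfl⟩
      have : deg c = deg (c - xyIdx m i) + 2 := by
        have h2 : deg (xyIdx m i) = 2 := by
          rw [s9_deg_eq2]
          simp [s9_xy_apply, Finset.sum_add_distrib]
        rw [← h2, s9_deg_eq, s9_deg_eq, s9_deg_eq, ← Finset.sum_add_distrib]
        apply Finset.sum_congr rfl
        rintro ⟨j, b⟩ _
        have := ho.1.pos
        have := ho.2.pos
        simp only [Finsupp.tsub_apply, s9_xy_apply]
        split_ifs with h
        · subst h; cases b <;> omega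
        · omega
      omega
    · exact Submodule.zero_mem _
  · exact Submodule.zero_mem _

/-- linear combination of the special monomials -/
def s9comb (K : Type) [Field K] (m : ℕ) : ((Fin m → Bool) → K) →ₗ[K] DPA K (Fin m × Bool) :=
  ∑ s, (LinearMap.toSpanSingleton K (DPA K (Fin m × Bool)) (Finsupp.single (s9e s) 1)).comp
    (LinearMap.proj s)

theorem s9comb_apply (K : Type) [Field K] (m : ℕ) (c : (Fin m → Bool) → K) :
    s9comb K m c = ∑ s, c s • Finsupp.single (s9e s) 1 := by
  simp [s9comb]

theorem s9_filter_eq (K : Type) [Field K] [CharP K 2] {m : ℕ} (z : DPA K (Fin m × Bool)) :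
    s9H K m (del K m z) + del K m (s9H K m z) =
      open Classical in z.filter (fun c => (s9ev c).Nonempty) := by
  classical
  induction z using Finsupp.induction_linear with
  | zero => simp [Finsupp.filter_zero]
  | add f g hf hg =>
    rw [Finsupp.filter_add, ← hf, ← hg]
    simp only [map_add]; abel
  | single a x =>
    have := congrArg (fun y => x • y) (s9_homotopy K a)
    have hx : (Finsupp.single a x : DPA K (Fin m × Bool)) = x • Finsupp.single a 1 := by simp
    rw [hx]
    simp only [map_smul, smul_add] at this ⊢
    rw [s9H_single, one_smul, this]
    by_cases h : (s9ev a).Nonempty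
    · rw [if_pos h, Finsupp.filter_smul, Finsupp.filter_single_of_pos (p := fun c => (s9ev c).Nonempty) h]
    · rw [if_neg h, Finsupp.filter_smul, Finsupp.filter_single_of_neg (p := fun c => (s9ev c).Nonempty) h]

theorem s9_ev_empty {m : ℕ} (c : (Fin m × Bool) →₀ ℕ) (hd : deg c = m)
    (h : ¬ (s9ev c).Nonempty) : ∃ s, c = s9e s := by
  have hodd : ∀ i, Odd (c (i, false) + c (i, true)) := by
    intro i
    rw [← Nat.not_even_iff_odd]
    intro hE
    exact h ⟨i, by simp [s9ev, hE]⟩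
  have h1 : ∀ i, c (i, false) + c (i, true) = 1 := by
    by_contra hcon
    push Not at hcon
    obtain ⟨i, hi⟩ := hcon
    have : ∑ i : Fin m, 1 < ∑ i, (c (i, false) + c (i, true)) := by
      apply Finset.sum_lt_sum
      · intro j _; exact (hodd j).pos
      · refine ⟨i, Finset.mem_univ _, ?_⟩
        have := (hodd i).pos
        omega
    rw [← s9_deg_eq2, hd] at this
    simp at this
  refine ⟨fun i => decide (c (i, true) = 1), ?_⟩
  ext ⟨i, b⟩
  rw [s9e_apply]
  have := h1 i
  cases b
  · by_cases h2 : c (i, true) = 1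
    · simp [h2]; omega
    · simp [h2]; omega
  · by_cases h2 : c (i, true) = 1
    · simp [h2]
    · simp [h2]; omega

theorem s9_eZ (K : Type) [Field K] [CharP K 2] {m : ℕ} (s : Fin m → Bool) :
    (Finsupp.single (s9e s) 1 : DPA K (Fin m × Bool)) ∈ Zmod K m m := by
  refine ⟨?_, ?_⟩
  · rw [SetLike.mem_coe, LinearMap.mem_ker, s9_del_single]
    apply Finset.sum_eq_zero
    intro j _
    rw [s9_cast_even, Finsupp.single_zero]
    rw [s9e_apply, s9e_apply]
    cases s j <;> decide
  · apply Submodule.subset_span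
    refine ⟨_, ?_, rfl⟩
    rw [s9_deg_eq2]
    simp only [s9e_apply]
    have : ∀ i : Fin m, ((if s i = false then 1 else 0) + if s i = true then 1 else 0) = 1 := by
      intro i; cases s i <;> simp
    simp [this]

theorem s9comb_Z (K : Type) [Field K] [CharP K 2] {m : ℕ} (c : (Fin m → Bool) → K) :
    s9comb K m c ∈ Zmod K m m := by
  rw [s9comb_apply]
  exact Submodule.sum_mem _ fun s _ => Submodule.smul_mem _ _ (s9_eZ K s)

theorem s9comb_coef (K : Type) [Field K] {m : ℕ} (c : (Fin m → Bool) → K) (t : Fin m → Bool) :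
    s9comb K m c (s9e t) = c t := by
  rw [s9comb_apply, Finsupp.finsetSum_apply, Finset.sum_eq_single t]
  · simp
  · intro s _ hs
    have : s9e s ≠ s9e t := fun h => hs (s9e_inj h)
    simp [Finsupp.single_apply, this]
  · simp

theorem s9_bd_coef (K : Type) [Field K] {m : ℕ} (y : DPA K (Fin m × Bool)) (t : Fin m → Bool) :
    del K m y (s9e t) = 0 := by
  induction y using Finsupp.induction_linear with
  | zero => simp
  | add f g hf hg => rw [map_add, Finsupp.add_apply, hf, hg, add_zero]
  | single a x =>
    have hx : (Finsupp.single a x : DPA K (Fin m × Bool)) = x • Finsupp.single a 1 := by simp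
    rw [hx, map_smul, s9_del_single, Finsupp.smul_apply, Finsupp.finsetSum_apply,
      Finset.sum_eq_zero, smul_zero]
    intro j _
    rw [Finsupp.single_apply, if_neg]
    intro h
    have h1 := DFunLike.congr_fun h (j, !(t j))
    rw [s9e_apply, Finsupp.add_apply, s9_xy_apply] at h1
    simp at h1

theorem s9_span (K : Type) [Field K] [CharP K 2] {m : ℕ} (z : DPA K (Fin m × Bool))
    (hz : z ∈ Zmod K m m) : z - s9comb K m (fun s => z (s9e s)) ∈ Bful K m m := by
  classical
  obtain ⟨hk, hD⟩ := hz
  rw [SetLike.mem_coe, LinearMap.mem_ker] at hk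
  rw [SetLike.mem_coe, s9_mem_Dsub] at hD
  refine ⟨s9H K m z, ?_, ?_⟩
  · have : s9H K m z = z.sum fun c x => x • s9Hm K c := by
      rfl
    rw [SetLike.mem_coe, this]
    apply Submodule.sum_mem
    intro c hc
    apply Submodule.smul_mem
    have := s9_Hm_deg K c
    rwa [hD c (Finsupp.mem_support_iff.1 hc)] at this
  · have h := s9_filter_eq K z
    rw [hk, map_zero, zero_add] at h
    rw [h]
    ext a
    rw [Finsupp.sub_apply]
    by_cases ha : ∃ t, a = s9e t
    · obtain ⟨t, rfl⟩ := ha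
      rw [s9comb_coef, sub_self, ← h, s9_bd_coef]
    · have h0 : s9comb K m (fun s => z (s9e s)) a = 0 := by
        rw [s9comb_apply, Finsupp.finsetSum_apply]
        apply Finset.sum_eq_zero
        intro s _
        rw [Finsupp.smul_apply, Finsupp.single_apply, if_neg, smul_zero]
        intro hh; exact ha ⟨s, hh.symm⟩
      rw [h0, sub_zero, Finsupp.filter_apply]
      split_ifs with hne
      · rfl
      · by_contra hza
        exact ha (s9_ev_empty a (hD a (Ne.symm hza)) hne)

theorem s9_act_comb (K : Type) [Field K] {m : ℕ} (i : Fin m) (b : Bool) (c : (Fin m → Bool) → K) :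
    act (s9g K i b) (s9comb K m c) = s9comb K m c + s9comb K m (fun t : Fin m → Bool =>
      if t i = !b then c (Function.update t i b) else 0) := by
  conv_lhs => rw [s9comb_apply, map_sum]
  simp only [map_smul, s9_act_e, smul_add, Finset.sum_add_distrib]
  rw [s9comb_apply, s9comb_apply]
  congr 1
  simp only [smul_ite, smul_zero, ite_smul, zero_smul]
  rw [← Finset.sum_filter, ← Finset.sum_filter]
  refine Finset.sum_bij' (fun s _ => Function.update s i (!b)) (fun s _ => Function.update s i b)
    ?_ ?_ ?_ ?_ ?_
  · intro s hs; simp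
  · intro s hs; simp
  · intro s hs
    simp only [Finset.mem_filter, Finset.mem_univ, true_and] at hs
    simp [← hs]
  · intro s hs
    simp only [Finset.mem_filter, Finset.mem_univ, true_and] at hs
    simp [← hs]
  · intro s hs
    simp only [Finset.mem_filter, Finset.mem_univ, true_and] at hs
    simp [← hs]

/-- The parametrization of `H^m`. -/
def s9Psi (K : Type) [Field K] [CharP K 2] (m : ℕ) : ((Fin m → Bool) → K) →ₗ[K] Hcoh K m m :=
  (toH K m m).comp ((s9comb K m).codRestrict (Zmod K m m) (s9comb_Z K))

theorem s9_toH_eq (K : Type) [Field K] [CharP K 2] (m : ℕ) (z : Zmod K m m) :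
    toH K m m z = s9Psi K m (fun s => (z : DPA K (Fin m × Bool)) (s9e s)) := by
  apply Subtype.ext
  change (Bful K m m).mkQ _ = (Bful K m m).mkQ _
  rw [Submodule.mkQ_apply, Submodule.mkQ_apply, Submodule.Quotient.eq]
  exact s9_span K _ z.2

theorem s9_toH_surj (K : Type) [Field K] (m : ℕ) : Function.Surjective (toH K m m) := by
  rintro ⟨x, z, hz, rfl⟩
  exact ⟨⟨z, hz⟩, rfl⟩

theorem s9Psi_surj (K : Type) [Field K] [CharP K 2] (m : ℕ) : Function.Surjective (s9Psi K m) := by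
  intro x
  obtain ⟨z, rfl⟩ := s9_toH_surj K m x
  exact ⟨_, (s9_toH_eq K m z).symm⟩

theorem s9Psi_inj (K : Type) [Field K] [CharP K 2] (m : ℕ) : Function.Injective (s9Psi K m) := by
  rw [← LinearMap.ker_eq_bot, LinearMap.ker_eq_bot']
  intro c hc
  have h := congrArg Subtype.val hc
  change (Bful K m m).mkQ (s9comb K m c) = 0 at h
  rw [Submodule.mkQ_apply, Submodule.Quotient.mk_eq_zero] at h
  obtain ⟨y, _, hy⟩ := h
  funext t
  rw [← s9comb_coef K c t, ← hy, s9_bd_coef]; rfl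

end Helpers

/-- Over an algebraically closed field of characteristic 2, `H^m(DV)` is an
irreducible `Sp(V)`-module: it is nonzero and its only `Sp(V)`-invariant subspaces are `0`
and the whole space. -/
theorem statement_9 (K : Type) [Field K] [IsAlgClosed K] [CharP K 2] (m : ℕ) (hm : 1 ≤ m) :
    Nontrivial (Hcoh K m m) ∧
    ∀ W : Submodule K (Hcoh K m m),
      (∀ g : Matrix (Fin m × Bool) (Fin m × Bool) K, IsSymplectic g →
        ∀ z w : ↥(Zmod K m m), (w : DPA K (Fin m × Bool)) = act g ↑z →
          toH K m m z ∈ W → toH K m m w ∈ W) →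
      W = ⊥ ∨ W = ⊤ := by
  constructor
  · exact (s9Psi_inj K m).nontrivial
  · intro W hW
    have hU : ∀ i b, ∀ c ∈ W.comap (s9Psi K m), (fun t : Fin m → Bool =>
        if t i = !b then c (Function.update t i b) else 0) ∈ W.comap (s9Psi K m) := by
      intro i b c hc
      rw [Submodule.mem_comap] at hc ⊢
      have := hW (s9g K i b) (s9g_symp K i b) ⟨s9comb K m c, s9comb_Z K c⟩
        ⟨s9comb K m (c + fun t : Fin m → Bool =>
          if t i = !b then c (Function.update t i b) else 0), s9comb_Z K _⟩
        (by rw [s9_act_comb, ← map_add]) hc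
      change s9Psi K m _ ∈ W at this
      rw [map_add] at this
      exact (Submodule.add_mem_iff_right W hc).1 this
    rcases s9_irr _ hU with h | h
    · left
      rw [eq_bot_iff]
      intro x hx
      obtain ⟨c, rfl⟩ := s9Psi_surj K m x
      have : c ∈ W.comap (s9Psi K m) := hx
      rw [h, Submodule.mem_bot] at this
      rw [this, map_zero]; exact Submodule.zero_mem _
    · right
      rw [eq_top_iff]
      rintro x -
      obtain ⟨c, rfl⟩ := s9Psi_surj K m x
      have : c ∈ W.comap (s9Psi K m) := by rw [h]; trivial
      exact this
end
end

section
/- Let K be a field of characteristic 2, V a K-vector space of dimension n with basis {v_1, ..., v_n}, and k ≥ 0 an integer. Let N be the subspace of D_{2k}V spanned by the monomials v_1^{(a_1)}···v_n^{(a_n)} with a_1 + ... + a_n = 2k in which at least one exponent a_i is odd. Then N is stable under the action of SL(n, K) on D_{2k}V (where g ∈ SL(n, K) acts via the induced algebra automorphism of DV determined by its action on V in the given basis). -/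
noncomputable section

open Finsupp TensorProduct

/-- The subspace `N` of `D_{2k}V` spanned by the monomials `v_1^{(a_1)} ⋯ v_n^{(a_n)}`,
`a_1 + ⋯ + a_n = 2k`, in which at least one exponent `a_i` is odd. -/
def Nodd (K ι : Type) [Field K] (k : ℕ) : Submodule K (DPA K ι) :=
  Submodule.span K {f | ∃ a : ι →₀ ℕ, deg a = 2 * k ∧ (∃ i, Odd (a i)) ∧
    f = Finsupp.single a (1 : K)}

/-- Auxiliary: span of the degree `d` monomials, having an odd exponent if `p` holds. -/
def auxT (K ι : Type) [Field K] (d : ℕ) (p : Prop) : Submodule K (DPA K ι) :=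
  Submodule.span K {f | ∃ a : ι →₀ ℕ, deg a = d ∧ (p → ∃ i, Odd (a i)) ∧
    f = Finsupp.single a (1 : K)}

theorem deg_add_aux {ι : Type} (a b : ι →₀ ℕ) : deg (a + b) = deg a + deg b := by
  unfold deg
  exact Finsupp.sum_add_index' (fun _ => rfl) (fun _ _ _ => rfl)

theorem even_choose_aux (m l : ℕ) (hm : Even m) (hl : Odd l) : Even (m.choose l) := by
  obtain ⟨l, rfl⟩ : ∃ l', l = l' + 1 := ⟨l - 1, by have := hl.pos; omega⟩
  rcases m with _ | m
  · simp
  · have h := Nat.add_one_mul_choose_eq m l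
    have h2 : Even ((m + 1).choose (l + 1) * (l + 1)) := by
      rw [← h]; exact hm.mul_right _
    rcases Nat.even_mul.mp h2 with h3 | h3
    · exact h3
    · exact absurd h3 (Nat.not_even_iff_odd.mpr hl)

theorem dpCoef_aux (K : Type) {ι : Type} [Field K] [CharP K 2] (a b : ι →₀ ℕ) (i : ι)
    (h : Odd (a i) ∨ Odd (b i)) (he : Even (a i + b i)) : (dpCoef a b : K) = 0 := by
  have ha : Odd (a i) := by
    rcases h with h | h
    · exact h
    · by_contra h'
      rw [Nat.not_odd_iff_even] at h'
      exact Nat.not_even_iff_odd.mpr (h'.add_odd h) he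
  have hc := even_choose_aux _ _ he ha
  have hd : (a i + b i).choose (a i) ∣ dpCoef a b := by
    unfold dpCoef Finsupp.prod
    apply Finset.dvd_prod_of_mem (fun j => (a j + b j).choose (a j))
    have := ha.pos
    simp only [Finsupp.mem_support_iff, Finsupp.add_apply]
    omega
  rw [CharP.cast_eq_zero_iff K 2]
  exact hc.two_dvd.trans hd

theorem auxT_mul (K : Type) {ι : Type} [Field K] [CharP K 2] {d e : ℕ} {p q : Prop}
    {x y : DPA K ι} (hx : x ∈ auxT K ι d p) (hy : y ∈ auxT K ι e q) :
    dpMul K ι x y ∈ auxT K ι (d + e) (p ∨ q) := by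
  induction hx using Submodule.span_induction with
  | zero => simp
  | add x x' _ _ h h' => rw [map_add, LinearMap.add_apply]; exact add_mem h h'
  | smul r x _ h => rw [map_smul, LinearMap.smul_apply]; exact Submodule.smul_mem _ _ h
  | mem x hx =>
    obtain ⟨a, ha, hpa, rfl⟩ := hx
    induction hy using Submodule.span_induction with
    | zero => simp
    | add x x' _ _ h h' => rw [map_add]; exact add_mem h h'
    | smul r x _ h => rw [map_smul]; exact Submodule.smul_mem _ _ h
    | mem y hy =>
      obtain ⟨b, hb, hqb, rfl⟩ := hy
      have hmul : dpMul K ι (Finsupp.single a 1) (Finsupp.single b 1) =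
          (dpCoef a b : K) • Finsupp.single (a + b) (1 : K) := by
        simp [dpMul]
      rw [hmul]
      by_cases hz : (dpCoef a b : K) = 0
      · rw [hz, zero_smul]; exact zero_mem _
      · refine Submodule.smul_mem _ _ (Submodule.subset_span ⟨a + b, ?_, ?_, rfl⟩)
        · rw [deg_add_aux, ha, hb]
        · intro hpq
          obtain ⟨i, hi⟩ : ∃ i, Odd (a i) ∨ Odd (b i) := by
            rcases hpq with h | h
            · obtain ⟨i, hi⟩ := hpa h
              exact ⟨i, Or.inl hi⟩
            · obtain ⟨i, hi⟩ := hqb h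
              exact ⟨i, Or.inr hi⟩
          refine ⟨i, ?_⟩
          by_contra ho
          rw [Nat.not_odd_iff_even] at ho
          exact hz (dpCoef_aux K a b i hi ho)

theorem auxT_dpow {K ι : Type} [Field K] [Fintype ι] [DecidableEq ι] (w : ι → K) (n : ℕ) :
    dpow w n ∈ auxT K ι n (Odd n) := by
  unfold dpow
  refine sum_mem fun c hc => ?_
  rw [Finset.mem_finsuppAntidiag] at hc
  rw [← mul_one (c.prod _), ← smul_eq_mul, ← Finsupp.smul_single]
  refine Submodule.smul_mem _ _ (Submodule.subset_span ⟨c, ?_, ?_, rfl⟩)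
  · unfold deg
    rw [Finsupp.sum_fintype _ _ (fun _ => rfl)]
    exact hc.1
  · intro hn
    by_contra! h
    simp only [Nat.not_odd_iff_even] at h
    rw [← hc.1, ← Nat.not_even_iff_odd] at hn
    exact hn (Finset.even_sum _ fun i _ => h i)

theorem auxT_foldr {K ι : Type} [Field K] [CharP K 2] [Fintype ι] [DecidableEq ι]
    (g : Matrix ι ι K) (a : ι →₀ ℕ) (l : List ι) :
    (l.map fun i => dpow (fun j => g j i) (a i)).foldr
      (fun p q => dpMul K ι p q) (Finsupp.single 0 1) ∈
      auxT K ι (l.map a).sum (∃ i ∈ l, Odd (a i)) := by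
  induction l with
  | nil => exact Submodule.subset_span ⟨0, by simp [deg], by simp, rfl⟩
  | cons i l ih =>
    have h := auxT_mul K (auxT_dpow (fun j => g j i) (a i)) ih
    simpa using h

/-- `N` is stable under the action of `SL(n, K)` on `D_{2k}V`. -/
theorem statement_10 (K : Type) [Field K] [CharP K 2] (n k : ℕ)
    (g : Matrix (Fin n) (Fin n) K) (hg : g.det = 1) :
    Submodule.map (act g) (Nodd K (Fin n) k) ≤ Nodd K (Fin n) k := by
  rw [Submodule.map_le_iff_le_comap]
  refine Submodule.span_le.mpr ?_
  rintro _ ⟨a, ha, ⟨i, hi⟩, rfl⟩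
  have h1 : act g (Finsupp.single a 1) = actMon g a := by simp [act]
  have h := auxT_foldr g a a.support.toList
  have hd : (a.support.toList.map a).sum = 2 * k := by
    rw [Finset.sum_map_toList]
    exact ha
  have hp : ∃ i ∈ a.support.toList, Odd (a i) := by
    refine ⟨i, ?_, hi⟩
    have := hi.pos
    simp only [Finset.mem_toList, Finsupp.mem_support_iff]
    omega
  show act g (Finsupp.single a 1) ∈ Nodd K (Fin n) k
  rw [h1]
  rw [hd] at h
  refine Submodule.span_mono ?_ h
  rintro f ⟨b, hb, hb2, rfl⟩
  exact ⟨b, hb, hb2 hp, rfl⟩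
end
end

section
/- Let K be a field of characteristic 2 and V a K-vector space of dimension 2m with symplectic basis x_1,y_1,...,x_m,y_m, DV its divided power algebra with differential ∂ given by multiplication by ω = x_1y_1 + ... + x_my_m. Let k ≥ 0 and let N ⊆ D_{2k}V be the span of the monomials x_1^{(a_1)}y_1^{(b_1)}···x_m^{(a_m)}y_m^{(b_m)} (Σ(a_i+b_i) = 2k) having at least one odd exponent. Then for every u ∈ N and every v ∈ ker ∂_m ⊆ D_mV, the product uv ∈ D_{m+2k}V lies in the image of ∂_{m+2k−2}. -/
noncomputable section

open Finsupp TensorProduct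

section helpers
variable {K ι : Type} [Field K]

theorem deg_add' (a b : ι →₀ ℕ) : deg (a + b) = deg a + deg b := by
  unfold deg
  exact Finsupp.sum_add_index' (fun _ => rfl) (fun _ _ _ => rfl)

theorem deg_single' (i : ι) (n : ℕ) : deg (Finsupp.single i n) = n := by
  unfold deg
  exact Finsupp.sum_single_index rfl

theorem dpCoef_eq [Fintype ι] (a b : ι →₀ ℕ) :
    dpCoef a b = ∏ i, Nat.choose (a i + b i) (a i) := by
  unfold dpCoef
  refine Finset.prod_subset (Finset.subset_univ _) ?_
  intro i _ hi
  have h : a i + b i = 0 := by simpa using hi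
  have h1 : a i = 0 := by omega
  have h2 : b i = 0 := by omega
  simp [h1, h2]

theorem dpCoef_comm [Fintype ι] (a b : ι →₀ ℕ) : dpCoef a b = dpCoef b a := by
  simp only [dpCoef_eq]
  refine Finset.prod_congr rfl fun i _ => ?_
  rw [add_comm (b i) (a i), Nat.choose_symm_add]

theorem choose_assoc_aux (a b c : ℕ) :
    Nat.choose (a + b) a * Nat.choose (a + b + c) (a + b)
      = Nat.choose (b + c) b * Nat.choose (a + (b + c)) a := by
  have h1 := Nat.add_choose_mul_factorial_mul_factorial a b
  have h2 := Nat.add_choose_mul_factorial_mul_factorial (a + b) c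
  have h3 := Nat.add_choose_mul_factorial_mul_factorial b c
  have h4 := Nat.add_choose_mul_factorial_mul_factorial a (b + c)
  rw [← Nat.choose_symm_add] at h1 h2 h3 h4
  have hp : 0 < a.factorial * b.factorial * c.factorial := by positivity
  refine Nat.eq_of_mul_eq_mul_right hp ?_
  rw [add_assoc a b c] at h2 ⊢
  calc _ = (a + (b + c)).choose (a + b) * ((a + b).choose a * a.factorial * b.factorial) * c.factorial := by ring
    _ = (a + (b + c)).choose a * a.factorial * ((b + c).choose b * b.factorial * c.factorial) := by
        rw [h1, h2, h3, h4]
    _ = _ := by ring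

theorem dpCoef_assoc [Fintype ι] (a b c : ι →₀ ℕ) :
    dpCoef a b * dpCoef (a + b) c = dpCoef b c * dpCoef a (b + c) := by
  simp only [dpCoef_eq, ← Finset.prod_mul_distrib]
  exact Finset.prod_congr rfl fun i _ => choose_assoc_aux (a i) (b i) (c i)

theorem dpMul_ss (a b : ι →₀ ℕ) (r s : K) :
    dpMul K ι (Finsupp.single a r) (Finsupp.single b s)
      = Finsupp.single (a + b) (r * s * (dpCoef a b : K)) := by
  simp only [dpMul, Finsupp.lsum_single, LinearMap.toSpanSingleton_apply, LinearMap.smul_apply,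
    Finsupp.smul_single, smul_eq_mul, mul_one, mul_assoc]

theorem dpMul_assoc' [Fintype ι] (f g h : DPA K ι) :
    dpMul K ι (dpMul K ι f g) h = dpMul K ι f (dpMul K ι g h) := by
  induction f using Finsupp.induction_linear with
  | zero => simp
  | add f1 f2 h1 h2 => simp only [map_add, LinearMap.add_apply, h1, h2]
  | single a r =>
    induction g using Finsupp.induction_linear with
    | zero => simp
    | add f1 f2 h1 h2 => simp only [map_add, LinearMap.add_apply, h1, h2]
    | single b s =>
      induction h using Finsupp.induction_linear with
      | zero => simp
      | add f1 f2 h1 h2 => simp only [map_add, h1, h2]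
      | single c t =>
        simp only [dpMul_ss, add_assoc]
        congr 1
        have := congrArg (Nat.cast : ℕ → K) (dpCoef_assoc a b c)
        push_cast at this
        linear_combination (r * s * t) * this

theorem dpMul_comm' [Fintype ι] (f g : DPA K ι) : dpMul K ι f g = dpMul K ι g f := by
  induction f using Finsupp.induction_linear with
  | zero => simp
  | add f1 f2 h1 h2 => simp only [map_add, LinearMap.add_apply, h1, h2]
  | single a r =>
    induction g using Finsupp.induction_linear with
    | zero => simp
    | add f1 f2 h1 h2 => simp only [map_add, LinearMap.add_apply, h1, h2]
    | single b s =>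
      rw [dpMul_ss, dpMul_ss, dpCoef_comm, add_comm a b, mul_comm r s]

/-- Partial derivative: `v_j^{(b)} ↦ v_j^{(b-1)}`. -/
def pd (K : Type) {ι : Type} [Field K] (j : ι) : DPA K ι →ₗ[K] DPA K ι :=
  Finsupp.lsum K fun b => LinearMap.toSpanSingleton K _
    (if b j = 0 then 0 else Finsupp.single (b - Finsupp.single j 1) (1 : K))

theorem pd_zero (j : ι) (b : ι →₀ ℕ) (r : K) (h : b j = 0) :
    pd K j (Finsupp.single b r) = 0 := by
  simp [pd, h]

theorem pd_succ (j : ι) (b : ι →₀ ℕ) (r : K) :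
    pd K j (Finsupp.single (b + Finsupp.single j 1) r) = Finsupp.single b r := by
  simp [pd, LinearMap.toSpanSingleton_apply]

theorem exists_succ (j : ι) (b : ι →₀ ℕ) (h : b j ≠ 0) :
    ∃ b' : ι →₀ ℕ, b = b' + Finsupp.single j 1 := by
  refine ⟨b - Finsupp.single j 1, ?_⟩
  classical
  ext i
  by_cases hi : j = i
  · subst hi; simp; omega
  · simp [Finsupp.single_apply, hi]

theorem dpCoef_split [Fintype ι] [DecidableEq ι] (j : ι) (a b : ι →₀ ℕ) :
    dpCoef a b = Nat.choose (a j + b j) (a j) *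
      ∏ i ∈ Finset.univ.erase j, Nat.choose (a i + b i) (a i) := by
  rw [dpCoef_eq, Finset.mul_prod_erase _ (fun i => Nat.choose (a i + b i) (a i)) (Finset.mem_univ j)]

theorem dpCoef_left_zero [Fintype ι] (j : ι) (a b : ι →₀ ℕ) (h : a j = 0) :
    dpCoef a (b + Finsupp.single j 1) = dpCoef a b := by
  classical
  rw [dpCoef_eq, dpCoef_eq]
  refine Finset.prod_congr rfl fun i _ => ?_
  by_cases hi : j = i
  · subst hi; simp [h]
  · simp [Finsupp.single_apply, hi]

theorem dpCoef_pascal [Fintype ι] (j : ι) (a b : ι →₀ ℕ) :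
    dpCoef (a + Finsupp.single j 1) (b + Finsupp.single j 1)
      = dpCoef a (b + Finsupp.single j 1) + dpCoef (a + Finsupp.single j 1) b := by
  classical
  set A : ι →₀ ℕ := a + Finsupp.single j 1 with hA
  set B : ι →₀ ℕ := b + Finsupp.single j 1 with hB
  have e : ∀ i ∈ Finset.univ.erase j, (Finsupp.single j 1 : ι →₀ ℕ) i = 0 := by
    intro i hi
    exact Finsupp.single_eq_of_ne (Finset.ne_of_mem_erase hi)
  have h1 : ∏ i ∈ Finset.univ.erase j, Nat.choose (A i + B i) (A i) = ∏ i ∈ Finset.univ.erase j, Nat.choose (a i + b i) (a i) :=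
    Finset.prod_congr rfl fun i hi => by simp [hA, hB, e i hi]
  have h2 : ∏ i ∈ Finset.univ.erase j, Nat.choose (a i + B i) (a i) = ∏ i ∈ Finset.univ.erase j, Nat.choose (a i + b i) (a i) :=
    Finset.prod_congr rfl fun i hi => by simp [hA, hB, e i hi]
  have h3 : ∏ i ∈ Finset.univ.erase j, Nat.choose (A i + b i) (A i) = ∏ i ∈ Finset.univ.erase j, Nat.choose (a i + b i) (a i) :=
    Finset.prod_congr rfl fun i hi => by simp [hA, hB, e i hi]
  rw [dpCoef_split j, dpCoef_split j a, dpCoef_split j A b, h1, h2, h3,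
    ← add_mul]
  congr 1
  simp only [hA, hB, Finsupp.add_apply, Finsupp.single_eq_same]
  rw [← add_assoc, Nat.choose_succ_succ']
  congr 2 <;> omega

theorem pd_mul [Fintype ι] (j : ι) (f g : DPA K ι) :
    pd K j (dpMul K ι f g) = dpMul K ι (pd K j f) g + dpMul K ι f (pd K j g) := by
  induction f using Finsupp.induction_linear with
  | zero => simp
  | add f1 f2 h1 h2 => simp only [map_add, LinearMap.add_apply, h1, h2]; abel
  | single a r =>
    induction g using Finsupp.induction_linear with
    | zero => simp
    | add f1 f2 h1 h2 => simp only [map_add, h1, h2]; abel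
    | single b s =>
      by_cases ha : a j = 0
      · by_cases hb : b j = 0
        · rw [dpMul_ss, pd_zero _ _ _ ha, pd_zero _ _ _ hb, pd_zero _ _ _ (by simp [ha, hb])]
          simp
        · obtain ⟨b, rfl⟩ := exists_succ j b hb
          rw [dpMul_ss, pd_zero _ _ _ ha, pd_succ, ← add_assoc, pd_succ, dpMul_ss,
            dpCoef_left_zero _ _ _ ha]
          simp
      · obtain ⟨a, rfl⟩ := exists_succ j a ha
        by_cases hb : b j = 0
        · rw [dpMul_ss, pd_zero _ _ _ hb, pd_succ, add_right_comm, pd_succ, dpMul_ss,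
            dpCoef_comm, dpCoef_left_zero _ _ _ hb, dpCoef_comm]
          simp
        · obtain ⟨b, rfl⟩ := exists_succ j b hb
          rw [dpMul_ss, pd_succ, pd_succ, ← add_assoc, pd_succ, dpMul_ss, dpMul_ss,
            dpCoef_pascal, ← add_assoc, add_right_comm a, ← Finsupp.single_add]
          congr 1
          push_cast
          ring

theorem pd_mem (j : ι) (k : ℕ) (f : DPA K ι) (hf : f ∈ Dsub K ι k) :
    pd K j f ∈ Dsub K ι (k - 1) := by
  suffices h : Dsub K ι k ≤ (Dsub K ι (k - 1)).comap (pd K j) from h hf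
  refine Submodule.span_le.2 ?_
  rintro _ ⟨a, ha, rfl⟩
  simp only [SetLike.mem_coe, Submodule.mem_comap]
  by_cases h : a j = 0
  · rw [pd_zero _ _ _ h]; exact zero_mem _
  · obtain ⟨a, rfl⟩ := exists_succ j a h
    rw [pd_succ]
    rw [deg_add', deg_single'] at ha
    exact Submodule.subset_span ⟨a, by omega, rfl⟩

theorem mul_mem' (a : ι →₀ ℕ) (k : ℕ) (f : DPA K ι) (hf : f ∈ Dsub K ι k) :
    dpMul K ι (Finsupp.single a 1) f ∈ Dsub K ι (deg a + k) := by
  suffices h : Dsub K ι k ≤ (Dsub K ι (deg a + k)).comap (dpMul K ι (Finsupp.single a 1)) from h hf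
  refine Submodule.span_le.2 ?_
  rintro _ ⟨b, hb, rfl⟩
  simp only [SetLike.mem_coe, Submodule.mem_comap, dpMul_ss]
  have : (Finsupp.single (a + b) (1 * 1 * (dpCoef a b : K)) : DPA K ι)
      = (dpCoef a b : K) • Finsupp.single (a + b) (1 : K) := by simp
  rw [this]
  exact Submodule.smul_mem _ _ (Submodule.subset_span ⟨a + b, by rw [deg_add', hb], rfl⟩)

theorem dpCoef_single [Fintype ι] (j : ι) (a : ι →₀ ℕ) :
    dpCoef a (Finsupp.single j 1) = a j + 1 := by
  classical
  rw [dpCoef_split j, Finset.prod_eq_one]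
  · simp
  · intro i hi
    rw [Finsupp.single_eq_of_ne (Finset.ne_of_mem_erase hi)]
    simp

theorem pd_omega (m : ℕ) (i : Fin m) (b : Bool) :
    pd K (i, !b) (omegaDP K m) = Finsupp.single (Finsupp.single (i, b) 1) 1 := by
  unfold omegaDP
  rw [map_sum, Finset.sum_eq_single i]
  · cases b
    · exact pd_succ _ _ _
    · unfold xyIdx
      rw [add_comm]
      exact pd_succ _ _ _
  · intro l _ hl
    apply pd_zero
    simp [xyIdx, Finsupp.single_apply, hl]
  · simp

end helpers

/-- For every `u ∈ N ⊆ D_{2k}V` and every `v ∈ ker ∂_m ⊆ D_m V`, the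
product `u v ∈ D_{m+2k}V` lies in the image of `∂_{m+2k-2}`. -/
theorem statement_12 (K : Type) [Field K] [CharP K 2] (m k : ℕ) (hm : 1 ≤ m)
    (u v : DPA K (Fin m × Bool)) (hu : u ∈ Nodd K (Fin m × Bool) k)
    (hv : v ∈ Zmod K m m) :
    dpMul K (Fin m × Bool) u v
      ∈ Submodule.map (del K m) (Dsub K (Fin m × Bool) (m + 2 * k - 2)) := by
  suffices h : Nodd K (Fin m × Bool) k ≤
      (Submodule.map (del K m) (Dsub K (Fin m × Bool) (m + 2 * k - 2))).comap
        ((dpMul K (Fin m × Bool)).flip v) from h hu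
  refine Submodule.span_le.2 ?_
  rintro _ ⟨a, ha, ⟨⟨i, b⟩, hodd⟩, rfl⟩
  simp only [SetLike.mem_coe, Submodule.mem_comap, LinearMap.flip_apply]
  obtain ⟨hker, hdeg⟩ := hv
  have hker' : dpMul K (Fin m × Bool) (omegaDP K m) v = 0 := hker
  obtain ⟨a', rfl⟩ := exists_succ (i, b) a (by intro h; rw [h] at hodd; simp at hodd)
  have hL := pd_mul (i, !b) (omegaDP K m) v
  rw [hker', map_zero, pd_omega] at hL
  have hz : dpMul K (Fin m × Bool) (omegaDP K m) (pd K (i, !b) v)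
      = - dpMul K (Fin m × Bool) (Finsupp.single (Finsupp.single (i, b) 1) 1) v :=
    eq_neg_of_add_eq_zero_right hL.symm
  have hc : ((dpCoef a' (Finsupp.single (i, b) 1) : ℕ) : K) = 1 := by
    rw [dpCoef_single]
    have : Odd (a' (i, b) + 1) := by simpa using hodd
    obtain ⟨n, hn⟩ := this
    rw [hn]
    push_cast
    rw [CharTwo.two_eq_zero]
    simp
  refine ⟨- dpMul K (Fin m × Bool) (Finsupp.single a' 1) (pd K (i, !b) v), ?_, ?_⟩
  · have h := mul_mem' a' _ _ (pd_mem (i, !b) m v hdeg)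
    rw [deg_add', deg_single'] at ha
    rw [show m + 2 * k - 2 = deg a' + (m - 1) by omega]
    exact neg_mem h
  · rw [map_neg]
    change - dpMul K (Fin m × Bool) (omegaDP K m) _ = _
    rw [← dpMul_assoc', dpMul_comm' (omegaDP K m), dpMul_assoc', hz, map_neg, neg_neg,
      ← dpMul_assoc', dpMul_ss, hc]
    simp
end
end
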